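/- Let ρ be a density matrix on ℂ^N and ε ≥ 0. Then the minimum of rank(σ) over σ ∈ B^ε(ρ) equals the minimum of rank(σ) over σ ∈ D^ε(ρ); consequently the smooth Renyi entropy of order 0, S_0^ε(ρ) = log₂ min_{σ∈B^ε(ρ)} rank(σ), can be computed by varying only the eigenvalues of ρ while keeping its eigenvectors. -/

import Mathlib

open Matrix
open scoped ComplexOrder
open Classical in
/-- The eigenvalues of a (Hermitian) matrix, listed in ascending order with
multiplicity; junk value `0` for non-Hermitian matrices. -/
noncomputable def eigAsc {N : ℕ} (A : Matrix (Fin N) (Fin N) ℂ) : Fin N → ℝ :=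
  if h : A.IsHermitian then fun i => h.eigenvalues (Tuple.sort h.eigenvalues i)
  else fun _ => 0

/-- The trace distance `‖A‖ = (1/2) ∑ᵢ |λᵢ^↑(A)|` (applied to `A = ρ - σ`). -/
noncomputable def trDist {N : ℕ} (A : Matrix (Fin N) (Fin N) ℂ) : ℝ :=
  (1 / 2) * ∑ i, |eigAsc A i|

/-- A density matrix: positive semidefinite with trace 1. -/
def IsDensity {N : ℕ} (ρ : Matrix (Fin N) (Fin N) ℂ) : Prop :=
  ρ.PosSemidef ∧ ρ.trace = 1

/-- The matrix `V diag(d) V*`. -/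
noncomputable def specM {N : ℕ} (V : Matrix (Fin N) (Fin N) ℂ) (d : Fin N → ℝ) :
    Matrix (Fin N) (Fin N) ℂ := V * diagonal (fun i => (d i : ℂ)) * Vᴴ

lemma eigAsc_mono {N : ℕ} (A : Matrix (Fin N) (Fin N) ℂ) : Monotone (eigAsc A) := by
  unfold eigAsc
  split_ifs with h
  · exact Tuple.monotone_sort h.eigenvalues
  · exact monotone_const

lemma specM_herm {N : ℕ} (V : Matrix (Fin N) (Fin N) ℂ) (d : Fin N → ℝ) :
    (specM V d).IsHermitian := by
  unfold specM
  apply isHermitian_mul_mul_conjTranspose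
  rw [isHermitian_diagonal_iff]
  intro i
  simp [IsSelfAdjoint]

lemma specM_sub {N : ℕ} (V : Matrix (Fin N) (Fin N) ℂ) (d e : Fin N → ℝ) :
    specM V d - specM V e = specM V (fun i => d i - e i) := by
  unfold specM
  rw [← sub_mul, ← mul_sub, diagonal_sub]
  simp

lemma specM_mul {N : ℕ} (V : Matrix (Fin N) (Fin N) ℂ) (hV : Vᴴ * V = 1) (d e : Fin N → ℝ) :
    specM V d * specM V e = specM V (fun i => d i * e i) := by
  unfold specM
  calc _ = V * diagonal (fun i => (d i : ℂ)) * (Vᴴ * V) * diagonal (fun i => (e i : ℂ)) * Vᴴ := by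
        simp only [mul_assoc]
    _ = _ := by
        rw [hV, mul_one, mul_assoc V, diagonal_mul_diagonal]; simp

lemma specM_trace {N : ℕ} (V : Matrix (Fin N) (Fin N) ℂ) (hV : Vᴴ * V = 1) (d : Fin N → ℝ) :
    (specM V d).trace = ((∑ i, d i : ℝ) : ℂ) := by
  unfold specM
  rw [trace_mul_comm, ← mul_assoc, hV, one_mul, trace_diagonal]; simp

lemma specM_rank {N : ℕ} (V : Matrix (Fin N) (Fin N) ℂ) (hV : Vᴴ * V = 1) (d : Fin N → ℝ) :
    (specM V d).rank = (Finset.univ.filter (fun i => d i ≠ 0)).card := by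
  have hV' : V * Vᴴ = 1 := mul_eq_one_comm.mp hV
  have h1 : IsUnit V.det := (isUnit_iff_isUnit_det V).mp (IsUnit.of_mul_eq_one _ hV')
  have h2 : IsUnit Vᴴ.det := (isUnit_iff_isUnit_det _).mp (IsUnit.of_mul_eq_one _ hV)
  unfold specM
  rw [rank_mul_eq_left_of_isUnit_det _ _ h2, rank_mul_eq_right_of_isUnit_det _ _ h1,
    rank_diagonal, Fintype.card_subtype]
  simp

lemma specM_psd {N : ℕ} (V : Matrix (Fin N) (Fin N) ℂ) (d : Fin N → ℝ) (hd : ∀ i, 0 ≤ d i) :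
    (specM V d).PosSemidef := by
  unfold specM
  apply PosSemidef.mul_mul_conjTranspose_same
  apply PosSemidef.diagonal
  intro i
  simpa using hd i

lemma exists_specM {N : ℕ} (A : Matrix (Fin N) (Fin N) ℂ) (hA : A.IsHermitian) :
    ∃ V : Matrix (Fin N) (Fin N) ℂ, Vᴴ * V = 1 ∧ A = specM V (eigAsc A) := by
  set U : Matrix (Fin N) (Fin N) ℂ := hA.eigenvectorUnitary.1 with hU
  have hUU : Uᴴ * U = 1 := Unitary.coe_star_mul_self hA.eigenvectorUnitary
  set e := Tuple.sort hA.eigenvalues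
  refine ⟨U.submatrix id e, ?_, ?_⟩
  · rw [conjTranspose_submatrix, submatrix_mul _ _ _ _ _ Function.bijective_id |>.symm, hUU]
    simp
  · have h := hA.spectral_theorem
    rw [Unitary.conjStarAlgAut_apply] at h
    have h3 : eigAsc A = fun i => hA.eigenvalues (e i) := by
      unfold eigAsc; rw [dif_pos hA]
    rw [h3]
    unfold specM
    have h4 : diagonal (fun i => ((hA.eigenvalues (e i) : ℝ) : ℂ)) =
        (diagonal (fun i => (hA.eigenvalues i : ℂ))).submatrix e e := by
      rw [submatrix_diagonal _ _ e.injective]; rfl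
    rw [h4, conjTranspose_submatrix, submatrix_mul _ _ _ _ _ e.bijective |>.symm,
      submatrix_mul _ _ _ _ _ e.bijective |>.symm]
    simpa using! h

lemma eigAsc_specM {N : ℕ} (V : Matrix (Fin N) (Fin N) ℂ) (hV : Vᴴ * V = 1) (d : Fin N → ℝ) :
    Finset.univ.val.map (eigAsc (specM V d)) = Finset.univ.val.map d := by
  have key : ∀ (W : Matrix (Fin N) (Fin N) ℂ) (f : Fin N → ℝ), Wᴴ * W = 1 →
      (specM W f).charpoly.roots = Finset.univ.val.map (fun i => (f i : ℂ)) := by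
    intro W f hW
    unfold specM
    rw [charpoly_mul_comm, ← mul_assoc, hW, one_mul, charpoly_diagonal, Polynomial.roots_prod]
    · simp
    · simp [Finset.prod_ne_zero_iff, Polynomial.X_sub_C_ne_zero]
  obtain ⟨W, hW, h⟩ := exists_specM _ (specM_herm V d)
  have h1 := key V d hV
  rw [h, key W _ hW] at h1
  have h2 := congrArg (Multiset.map Complex.re) h1
  simpa [Multiset.map_map, Function.comp_def] using! h2

lemma eigAsc_specM_mono {N : ℕ} (V : Matrix (Fin N) (Fin N) ℂ) (hV : Vᴴ * V = 1) (d : Fin N → ℝ)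
    (hd : Monotone d) : eigAsc (specM V d) = d := by
  have h := eigAsc_specM V hV d
  rw [Fin.univ_val_map, Fin.univ_val_map, Multiset.coe_eq_coe] at h
  exact List.ofFn_injective (h.eq_of_pairwise'
      (eigAsc_mono _).sortedLE_ofFn.pairwise hd.sortedLE_ofFn.pairwise)

lemma trDist_specM {N : ℕ} (V : Matrix (Fin N) (Fin N) ℂ) (hV : Vᴴ * V = 1) (d : Fin N → ℝ) :
    trDist (specM V d) = (1 / 2) * ∑ i, |d i| := by
  have h := congrArg (fun s => (s.map (fun x : ℝ => |x|)).sum) (eigAsc_specM V hV d)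
  simp only [Multiset.map_map, Function.comp_def] at h
  unfold trDist
  congr 1

lemma eigAsc_nonneg {N : ℕ} (A : Matrix (Fin N) (Fin N) ℂ) (hA : A.PosSemidef) (i : Fin N) :
    0 ≤ eigAsc A i := by
  unfold eigAsc
  rw [dif_pos hA.1]
  exact hA.eigenvalues_nonneg _

/-- Ordered nonnegative tuples vanish on the first `N - r` places. -/
lemma zero_of_card {N : ℕ} (s : Fin N → ℝ) (hs : Monotone s) (h0 : ∀ i, 0 ≤ s i) (i : Fin N)
    (hi : i.val < N - (Finset.univ.filter (fun i => s i ≠ 0)).card) : s i = 0 := by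
  by_contra hne
  have hpos : 0 < s i := lt_of_le_of_ne (h0 i) (Ne.symm hne)
  have hsub : Finset.Ici i ⊆ Finset.univ.filter (fun i => s i ≠ 0) := by
    intro j hj
    have := hs (Finset.mem_Ici.mp hj)
    simp only [Finset.mem_filter, Finset.mem_univ, true_and]
    exact (hpos.trans_le this).ne'
  have := Finset.card_le_card hsub
  rw [Fin.card_Ici] at this
  omega

/-- Overlap matrix of two unitaries: trace formula. -/
lemma trace_specM_mul {N : ℕ} (V W : Matrix (Fin N) (Fin N) ℂ) (d e : Fin N → ℝ) :
    (specM W e * specM V d).trace =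
      ((∑ i, d i * ∑ j, e j * Complex.normSq ((Vᴴ * W) i j) : ℝ) : ℂ) := by
  have h : (specM W e * specM V d).trace =
      (diagonal (fun i => (d i : ℂ)) * ((Vᴴ * W) * (diagonal (fun i => (e i : ℂ)) *
        (Vᴴ * W)ᴴ))).trace := by
    unfold specM
    rw [conjTranspose_mul, conjTranspose_conjTranspose]
    rw [trace_mul_comm, mul_assoc V, mul_assoc V, trace_mul_comm V]
    simp only [mul_assoc]
  rw [h, trace]
  push_cast
  apply Finset.sum_congr rfl
  intro i _
  rw [diag_apply, diagonal_mul, mul_apply]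
  congr 1
  apply Finset.sum_congr rfl
  intro j _
  rw [diagonal_mul, conjTranspose_apply, Complex.normSq_eq_conj_mul_self]
  simp only [RCLike.star_def]
  ring

lemma normSq_row {N : ℕ} (X : Matrix (Fin N) (Fin N) ℂ) (hX : X * Xᴴ = 1) (i : Fin N) :
    ∑ j, Complex.normSq (X i j) = 1 := by
  have h := congrFun (congrFun hX i) i
  rw [mul_apply, one_apply_eq] at h
  have : ((∑ j, Complex.normSq (X i j) : ℝ) : ℂ) = 1 := by
    rw [← h]; push_cast
    apply Finset.sum_congr rfl
    intro j _
    rw [conjTranspose_apply, Complex.normSq_eq_conj_mul_self, mul_comm]; rfl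
  exact_mod_cast this

lemma normSq_col {N : ℕ} (X : Matrix (Fin N) (Fin N) ℂ) (hX : Xᴴ * X = 1) (j : Fin N) :
    ∑ i, Complex.normSq (X i j) = 1 := by
  have h := normSq_row Xᴴ (by simpa using hX) j
  simpa [conjTranspose_apply] using h

/-- Weights of an initial-segment projection. -/
lemma weights {N : ℕ} (X : Matrix (Fin N) (Fin N) ℂ) (hX : Xᴴ * X = 1) (e : Fin N → ℝ)
    (he0 : ∀ i, 0 ≤ e i) (he1 : ∀ i, e i ≤ 1) :
    (∀ i, 0 ≤ ∑ j, e j * Complex.normSq (X i j)) ∧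
    (∀ i, ∑ j, e j * Complex.normSq (X i j) ≤ 1) ∧
    ∑ i, ∑ j, e j * Complex.normSq (X i j) = ∑ j, e j := by
  refine ⟨fun i => Finset.sum_nonneg fun j _ => mul_nonneg (he0 j) (Complex.normSq_nonneg _),
    fun i => ?_, ?_⟩
  · rw [← normSq_row X (mul_eq_one_comm.mp hX) i]
    apply Finset.sum_le_sum
    intro j _
    exact mul_le_of_le_one_left (Complex.normSq_nonneg _) (he1 j)
  · rw [Finset.sum_comm]
    apply Finset.sum_congr rfl
    intro j _
    rw [← Finset.mul_sum, normSq_col X hX, mul_one]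

/-- Indicator of the first `k` places. -/
noncomputable def ind {N : ℕ} (k : ℕ) (i : Fin N) : ℝ := if i.val < k then 1 else 0

/-- Ky Fan type inequality for monotone tuples. -/
lemma kyfan {N : ℕ} (p : Fin N → ℝ) (hp : Monotone p) (w : Fin N → ℝ) (k : ℕ) (hk : k < N)
    (h0 : ∀ i, 0 ≤ w i) (h1 : ∀ i, w i ≤ 1) (hs : ∑ i, w i = ∑ i : Fin N, ind k i) :
    ∑ i, p i * ind k i ≤ ∑ i, p i * w i := by
  have h : ∑ i, p ⟨k, hk⟩ * (w i - ind k i) = 0 := by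
    rw [← Finset.mul_sum, Finset.sum_sub_distrib, hs]; simp
  have h2 : ∑ i, p ⟨k, hk⟩ * (w i - ind k i) ≤ ∑ i, p i * (w i - ind k i) := by
    apply Finset.sum_le_sum
    intro i _
    unfold ind
    split_ifs with hi
    · have : p i ≤ p ⟨k, hk⟩ := hp (by rw [Fin.le_def]; exact hi.le)
      nlinarith [h1 i]
    · have : p ⟨k, hk⟩ ≤ p i := hp (by rw [Fin.le_def]; exact not_lt.mp hi)
      nlinarith [h0 i]
  simp only [mul_sub, Finset.sum_sub_distrib] at h h2
  linarith

lemma sum_le_half_abs {N : ℕ} (a w : Fin N → ℝ) (ha : ∑ i, a i = 0)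
    (h0 : ∀ i, 0 ≤ w i) (h1 : ∀ i, w i ≤ 1) : ∑ i, a i * w i ≤ (1 / 2) * ∑ i, |a i| := by
  have : ∑ i, a i * w i ≤ ∑ i, ((1 / 2) * |a i| + (1 / 2) * a i) := by
    apply Finset.sum_le_sum
    intro i _
    rcases abs_cases (a i) with ⟨h, h'⟩ | ⟨h, h'⟩ <;> rw [h] <;> nlinarith [h0 i, h1 i]
  rw [Finset.sum_add_distrib, ← Finset.mul_sum, ← Finset.mul_sum, ha] at this
  linarith

lemma sum_eigAsc {N : ℕ} (A : Matrix (Fin N) (Fin N) ℂ) (hA : A.IsHermitian) :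
    ((∑ i, eigAsc A i : ℝ) : ℂ) = A.trace := by
  obtain ⟨V, hV, h⟩ := exists_specM A hA
  conv_rhs => rw [h, specM_trace V hV]

lemma rank_eig {N : ℕ} (A : Matrix (Fin N) (Fin N) ℂ) (hA : A.IsHermitian) :
    A.rank = (Finset.univ.filter (fun i => eigAsc A i ≠ 0)).card := by
  obtain ⟨V, hV, h⟩ := exists_specM A hA
  conv_lhs => rw [h, specM_rank V hV]

lemma density_rank {N : ℕ} (σ : Matrix (Fin N) (Fin N) ℂ) (hσ : IsDensity σ) :
    N - σ.rank < N := by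
  have h1 : 0 < σ.rank := by
    rw [Nat.pos_iff_ne_zero]
    intro h
    rw [rank_eig σ hσ.1.1, Finset.card_eq_zero, Finset.filter_eq_empty_iff] at h
    have h2 := sum_eigAsc σ hσ.1.1
    rw [hσ.2, Finset.sum_eq_zero (fun i hi => not_not.mp (h hi))] at h2
    simp at h2
  have h2 : σ.rank ≤ N := by simpa using σ.rank_le_card_width
  omega

lemma lower_D {N : ℕ} (ρ σ : Matrix (Fin N) (Fin N) ℂ) (hρ : IsDensity ρ) (hσ : IsDensity σ) :
    ∑ i, eigAsc ρ i * ind (N - σ.rank) i ≤ (1 / 2) * ∑ i, |eigAsc ρ i - eigAsc σ i| := by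
  have h0 : ∑ i, (eigAsc ρ i - eigAsc σ i) = 0 := by
    rw [Finset.sum_sub_distrib]
    have h1 := sum_eigAsc ρ hρ.1.1
    have h2 := sum_eigAsc σ hσ.1.1
    rw [hρ.2, ← hσ.2, ← h2] at h1
    rw [sub_eq_zero]
    exact_mod_cast h1
  refine le_trans (le_of_eq ?_) (sum_le_half_abs _ (ind (N - σ.rank)) h0 ?_ ?_)
  · apply Finset.sum_congr rfl
    intro i _
    unfold ind
    split_ifs with hi
    · rw [rank_eig σ hσ.1.1] at hi
      rw [zero_of_card _ (eigAsc_mono σ) (eigAsc_nonneg σ hσ.1) i hi]; simp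
    · simp
  · intro i; unfold ind; split_ifs <;> norm_num
  · intro i; unfold ind; split_ifs <;> norm_num

lemma lower_B {N : ℕ} (ρ σ : Matrix (Fin N) (Fin N) ℂ) (hρ : IsDensity ρ) (hσ : IsDensity σ) :
    ∑ i, eigAsc ρ i * ind (N - σ.rank) i ≤ trDist (ρ - σ) := by
  have hk := density_rank σ hσ
  set k := N - σ.rank with hkdef
  have i0 : ∀ i : Fin N, 0 ≤ ind k i := by intro i; unfold ind; split_ifs <;> norm_num
  have i1 : ∀ i : Fin N, ind k i ≤ 1 := by intro i; unfold ind; split_ifs <;> norm_num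
  have hA : (ρ - σ).IsHermitian := hρ.1.1.sub hσ.1.1
  obtain ⟨V, hV, hVρ⟩ := exists_specM ρ hρ.1.1
  obtain ⟨W, hW, hWσ⟩ := exists_specM σ hσ.1.1
  obtain ⟨T, hT, hTA⟩ := exists_specM _ hA
  have hu : ∀ Y : Matrix (Fin N) (Fin N) ℂ, Yᴴ * Y = 1 → (Yᴴ * W)ᴴ * (Yᴴ * W) = 1 := by
    intro Y hY
    have hY' : Y * Yᴴ = 1 := mul_eq_one_comm.mp hY
    rw [conjTranspose_mul, conjTranspose_conjTranspose, mul_assoc, ← mul_assoc Y, hY', one_mul, hW]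
  have hPσ : specM W (ind k) * σ = 0 := by
    conv_lhs => rw [hWσ]
    rw [specM_mul W hW]
    have : (fun i => ind k i * eigAsc σ i) = fun _ => 0 := by
      funext i
      unfold ind
      split_ifs with hi
      · rw [hkdef, rank_eig σ hσ.1.1] at hi
        rw [zero_of_card _ (eigAsc_mono σ) (eigAsc_nonneg σ hσ.1) i hi]; simp
      · simp
    rw [this]
    simp [specM]
  have htr : (specM W (ind k) * ρ).trace = (specM W (ind k) * (ρ - σ)).trace := by
    rw [mul_sub, hPσ, sub_zero]
  rw [hTA, trace_specM_mul] at htr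
  conv_lhs at htr => rw [hVρ, trace_specM_mul]
  have htr' := Complex.ofReal_injective htr
  obtain ⟨a0, a1, a2⟩ := weights _ (hu V hV) (ind k) i0 i1
  obtain ⟨b0, b1, b2⟩ := weights _ (hu T hT) (ind k) i0 i1
  have hz : ∑ i, eigAsc (ρ - σ) i = 0 := by
    have := sum_eigAsc _ hA
    rw [trace_sub, hρ.2, hσ.2, sub_self] at this
    exact_mod_cast this
  calc _ ≤ _ := kyfan _ (eigAsc_mono ρ) _ k hk a0 a1 a2
    _ = _ := htr'
    _ ≤ _ := sum_le_half_abs _ _ hz b0 b1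
    _ = _ := rfl

lemma construct {N : ℕ} (ρ : Matrix (Fin N) (Fin N) ℂ) (hρ : IsDensity ρ) (k : ℕ) (hk : k < N) :
    ∃ σ, IsDensity σ ∧ σ * ρ = ρ * σ ∧ σ.rank ≤ N - k ∧
      trDist (ρ - σ) = ∑ i, eigAsc ρ i * ind k i ∧
      (1 / 2) * ∑ i, |eigAsc ρ i - eigAsc σ i| = ∑ i, eigAsc ρ i * ind k i := by
  obtain ⟨V, hV, hVρ⟩ := exists_specM ρ hρ.1.1
  have hp := eigAsc_mono ρ
  have hp0 := eigAsc_nonneg ρ hρ.1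
  have hsum : ∑ i, eigAsc ρ i = 1 := by
    have := sum_eigAsc _ hρ.1.1
    rw [hρ.2] at this
    exact_mod_cast this
  set p := eigAsc ρ with hpdef
  clear_value p
  subst hVρ
  set t := ∑ i, p i * ind k i with ht
  have ht0 : 0 ≤ t := Finset.sum_nonneg fun i _ =>
    mul_nonneg (hp0 i) (by unfold ind; split_ifs <;> norm_num)
  let l : Fin N := ⟨N - 1, by omega⟩
  let q : Fin N → ℝ := fun i => p i - p i * ind k i + if i = l then t else 0
  have hq0 : ∀ i, 0 ≤ q i := by
    intro i
    have := hp0 i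
    simp only [q, ind]
    split_ifs <;> simp <;> linarith
  have hqm : Monotone q := by
    intro i j hij
    have h1 := hp hij
    have h2 := hp0 i
    have h3 := hp0 j
    have h4 : i = l → j = l := by
      intro h; subst h; apply Fin.ext; have := Fin.le_def.mp hij; simp only [l] at this ⊢; omega
    have h5 : j.val < k → i.val < k := fun h => lt_of_le_of_lt (Fin.le_def.mp hij) h
    have h6 : p i - p i * ind k i ≤ p j - p j * ind k j := by
      unfold ind
      split_ifs with hi hj hj
      · simp
      · simpa using h3
      · exact absurd (h5 hj) hi
      · simpa using h1
    have h7 : (if i = l then t else 0) ≤ (if j = l then t else 0) := by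
      split_ifs with hi hj hj
      · exact le_refl _
      · exact absurd (h4 hi) hj
      · exact ht0
      · exact le_refl _
    exact add_le_add h6 h7
  have hd : (1 / 2) * ∑ i, |p i - q i| = t := by
    have : ∀ i, |p i - q i| = p i * ind k i + if i = l then t else 0 := by
      intro i
      have := hp0 i
      simp only [q, ind]
      by_cases hi : i.val < k
      · have hil : i ≠ l := by intro h; subst h; simp only [l] at hi; omega
        simp [hi, hil, abs_of_nonneg this]
      · by_cases hil : i = l
        · simp only [hi, hil, if_true, if_false]
          have : ¬ (l.val < k) := by rw [← hil]; exact hi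
          simp [this, abs_of_nonneg ht0]
        · simp [hi, hil]
    rw [Finset.sum_congr rfl (fun i _ => this i), Finset.sum_add_distrib, ← ht]
    simp only [Finset.sum_ite_eq', Finset.mem_univ, if_true]
    ring
  refine ⟨specM V q, ⟨specM_psd V q hq0, ?_⟩, ?_, ?_, ?_, ?_⟩
  · rw [specM_trace V hV]
    have : ∑ i, q i = 1 := by
      simp only [q, Finset.sum_add_distrib, Finset.sum_sub_distrib, hsum, ← ht]
      simp
    rw [this]; simp
  · rw [specM_mul V hV, specM_mul V hV]
    simp only [mul_comm]
  · rw [specM_rank V hV]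
    have : Finset.univ.filter (fun i => q i ≠ 0) ⊆ Finset.Ici ⟨k, hk⟩ := by
      intro i hi
      simp only [Finset.mem_filter, Finset.mem_univ, true_and] at hi
      rw [Finset.mem_Ici, Fin.le_def]
      by_contra hlt
      have hlt : i.val < k := not_le.mp hlt
      apply hi
      have hil : i ≠ l := by intro h; subst h; simp only [l] at hlt; omega
      simp [q, ind, hlt, hil]
    have := Finset.card_le_card this
    rwa [Fin.card_Ici] at this
  · rw [specM_sub, trDist_specM V hV, hd]
  · rw [eigAsc_specM_mono V hV q hqm, hd]

theorem stmt4 {N : ℕ} (ρ : Matrix (Fin N) (Fin N) ℂ) (hρ : IsDensity ρ)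
    (ε : ℝ) (hε : 0 ≤ ε) :
    sInf {r : ℕ | ∃ σ, IsDensity σ ∧ trDist (ρ - σ) ≤ ε ∧ σ.rank = r} =
    sInf {r : ℕ | ∃ σ, IsDensity σ ∧ σ * ρ = ρ * σ ∧
      (1 / 2) * ∑ i, |eigAsc ρ i - eigAsc σ i| ≤ ε ∧ σ.rank = r} := by
  have key : ∀ σ : Matrix (Fin N) (Fin N) ℂ, IsDensity σ →
      ∑ i, eigAsc ρ i * ind (N - σ.rank) i ≤ ε →
      ∃ τ, IsDensity τ ∧ τ * ρ = ρ * τ ∧ τ.rank ≤ σ.rank ∧ trDist (ρ - τ) ≤ ε ∧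
        (1 / 2) * ∑ i, |eigAsc ρ i - eigAsc τ i| ≤ ε := by
    intro σ hσ h
    obtain ⟨τ, t1, t2, t3, t4, t5⟩ := construct ρ hρ _ (density_rank σ hσ)
    have h2 : σ.rank ≤ N := by simpa using σ.rank_le_card_width
    exact ⟨τ, t1, t2, by omega, t4 ▸ h, t5 ▸ h⟩
  have hz : trDist (ρ - ρ) ≤ ε := by
    have : ρ - ρ = specM 1 (fun _ => 0) := by simp [specM]
    rw [this, trDist_specM 1 (by simp)]
    simpa using hε
  apply le_antisymm
  · apply le_csInf
    · exact ⟨ρ.rank, ρ, hρ, rfl, by simpa using hε, rfl⟩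
    · rintro r ⟨σ, hσ, -, h, rfl⟩
      obtain ⟨τ, t1, t2, t3, t4, t5⟩ := key σ hσ ((lower_D ρ σ hρ hσ).trans h)
      exact le_trans (Nat.sInf_le ⟨τ, t1, t4, rfl⟩) t3
  · apply le_csInf
    · exact ⟨ρ.rank, ρ, hρ, hz, rfl⟩
    · rintro r ⟨σ, hσ, h, rfl⟩
      obtain ⟨τ, t1, t2, t3, t4, t5⟩ := key σ hσ ((lower_B ρ σ hρ hσ).trans h)
      exact le_trans (Nat.sInf_le ⟨τ, t1, t2, t5, rfl⟩) t3
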